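/- Let (Θ,d) be a complete separable metric space with d ≤ 1. For n = 1,2,…,∞ let M_n be a shift-stationary Borel probability measure on Θ^ℕ₀ with invariant probability measure Π_n on Θ, suppose M_∞ is in addition ergodic, and let e_m be the empirical distribution map. If w_∞(M_n, M_∞) → 0 as n → ∞, where w_∞ is the bounded Lipschitz metric on probability measures on Θ^ℕ₀ induced by d_∞(θ¹_∞,θ²_∞) = Σ_{i=0}^∞ 2^{−i−1} d(θ¹(i),θ²(i)), then for every sequence m_n → ∞, R_{m_n}(M_n, Π_n) → 0, where R_m(M,Π) = ∫_{Θ^ℕ₀} w(e_m(θ(0),…,θ(m−1)), Π) M(dθ_∞); that is, the sequence of procedures is consistent to (Π_n). -/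

import Mathlib

open MeasureTheory ProbabilityTheory Filter Topology Matrix ENNReal

/-- The class `BL₁(Θ)` of Borel measurable functions `f : Θ → ℝ` with
`|f s - f t| ≤ d(s,t)` for all `s, t`. -/
def BLone (Θ : Type*) [MeasurableSpace Θ] [PseudoMetricSpace Θ] : Set (Θ → ℝ) :=
  {f | Measurable f ∧ ∀ s t : Θ, |f s - f t| ≤ dist s t}

/-- The bounded Lipschitz distance `w(μ,ν) = sup_{f ∈ BL₁} |∫ f dμ - ∫ f dν|`. -/
noncomputable def blDist {Θ : Type*} [MeasurableSpace Θ] [PseudoMetricSpace Θ]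
    (μ ν : Measure Θ) : ℝ :=
  ⨆ f ∈ BLone Θ, |∫ x, f x ∂μ - ∫ x, f x ∂ν|

/-- The empirical distribution `e_m(θ(0),…,θ(m-1)) = (1/m) ∑_{i<m} δ_{θ(i)}`. -/
noncomputable def emp {Θ : Type*} [MeasurableSpace Θ] (θ : ℕ → Θ) (m : ℕ) : Measure Θ :=
  (m : ℝ≥0∞)⁻¹ • ∑ i ∈ Finset.range m, Measure.dirac (θ i)

/-- The risk `R_m(M,Π) = ∫ w(e_m(θ(0),…,θ(m-1)), Π) M(dθ_∞)`. -/
noncomputable def risk {Θ : Type*} [MeasurableSpace Θ] [PseudoMetricSpace Θ]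
    (M : Measure (ℕ → Θ)) (target : Measure Θ) (m : ℕ) : ℝ :=
  ∫ θ, blDist (emp θ m) target ∂M

/-- The shift `T(θ(0),θ(1),…) = (θ(1),θ(2),…)` on `Θ^{ℕ₀}`. -/
def shift {Θ : Type*} (θ : ℕ → Θ) : ℕ → Θ := fun i => θ (i + 1)

/-- The metric `d_∞(θ¹,θ²) = ∑_i 2^{-i-1} d(θ¹(i),θ²(i))` on `Θ^{ℕ₀}`. -/
noncomputable def dInfty {Θ : Type*} [PseudoMetricSpace Θ] (a b : ℕ → Θ) : ℝ :=
  ∑' i : ℕ, (2 : ℝ)⁻¹ ^ (i + 1) * dist (a i) (b i)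

/-- Measurable functions on `Θ^{ℕ₀}` that are `1`-Lipschitz for the metric `d_∞`. -/
def BLoneSeq (Θ : Type*) [MeasurableSpace Θ] [PseudoMetricSpace Θ] : Set ((ℕ → Θ) → ℝ) :=
  {f | Measurable f ∧ ∀ a b : ℕ → Θ, |f a - f b| ≤ dInfty a b}

/-- The bounded Lipschitz distance `w_∞` on (probability) measures on `Θ^{ℕ₀}`,
induced by the metric `d_∞`. -/
noncomputable def blDistInfty {Θ : Type*} [MeasurableSpace Θ] [PseudoMetricSpace Θ]
    (M N : Measure (ℕ → Θ)) : ℝ :=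
  ⨆ f ∈ BLoneSeq Θ, |∫ θ, f θ ∂M - ∫ θ, f θ ∂N|

/-- A measure preserving map preserves integrals, iterated version. -/
theorem MeasureTheory.MeasurePreserving.integral_comp_iterate {α : Type*} [MeasurableSpace α]
    {μ : Measure α} {T : α → α} (hT : MeasurePreserving T μ μ) {u : α → ℝ}
    (hu : AEStronglyMeasurable u μ) (i : ℕ) : ∫ x, u (T^[i] x) ∂μ = ∫ x, u x ∂μ := by
  have h := hT.iterate i
  have hu' : AEStronglyMeasurable u (μ.map T^[i]) := by rwa [h.map_eq]
  rw [← integral_map h.aemeasurable hu', h.map_eq]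

/-- Birkhoff averages of an integrable function along a measure preserving map are integrable. -/
theorem MeasureTheory.MeasurePreserving.integrable_birkhoffAverage {α : Type*}
    [MeasurableSpace α] {μ : Measure α} {T : α → α} (hT : MeasurePreserving T μ μ) {u : α → ℝ}
    (hu : Integrable u μ) (m : ℕ) : Integrable (fun x => birkhoffAverage ℝ T u m x) μ := by
  simp only [birkhoffAverage, birkhoffSum]
  exact (integrable_finsetSum _ fun i _ =>
    (hT.iterate i).integrable_comp_of_integrable hu).smul (m : ℝ)⁻¹

/-- Birkhoff averages along a measure preserving map have the same mean as the function. -/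
theorem MeasureTheory.MeasurePreserving.integral_birkhoffAverage {α : Type*} [MeasurableSpace α]
    {μ : Measure α} {T : α → α} (hT : MeasurePreserving T μ μ) {u : α → ℝ}
    (hu : Integrable u μ) {m : ℕ} (hm : m ≠ 0) :
    ∫ x, birkhoffAverage ℝ T u m x ∂μ = ∫ x, u x ∂μ := by
  simp only [birkhoffAverage, birkhoffSum]
  have hi (i : ℕ) : Integrable (fun x => u (T^[i] x)) μ :=
    (hT.iterate i).integrable_comp_of_integrable hu
  rw [integral_smul, integral_finsetSum _ fun i _ => hi i]
  simp only [hT.integral_comp_iterate hu.aestronglyMeasurable]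
  simp [hm]

/-- Averaging along a measure preserving map is a contraction of `L¹`. -/
theorem MeasureTheory.MeasurePreserving.integral_abs_birkhoffAverage_le {α : Type*}
    [MeasurableSpace α] {μ : Measure α} {T : α → α} (hT : MeasurePreserving T μ μ) {u : α → ℝ}
    (hu : Integrable u μ) {m : ℕ} (hm : m ≠ 0) :
    ∫ x, |birkhoffAverage ℝ T u m x| ∂μ ≤ ∫ x, |u x| ∂μ := by
  rw [← hT.integral_birkhoffAverage hu.abs hm]
  refine integral_mono (hT.integrable_birkhoffAverage hu m).abs
    (hT.integrable_birkhoffAverage hu.abs m) fun x => ?_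
  simp only [birkhoffAverage, birkhoffSum, smul_eq_mul, abs_mul]
  rw [abs_of_nonneg (by positivity)]
  gcongr
  exact Finset.abs_sum_le_sum_abs _ _

/-- Along an orbit, averages of length `m` and averages of length `m` of averages of length `k`
differ by at most `k / m` times the oscillation of the function. -/
theorem abs_birkhoffAverage_birkhoffAverage_sub_le {α : Type*} {T : α → α} {u : α → ℝ}
    (hu : ∀ x y, |u x - u y| ≤ 1) {k : ℕ} (hk : k ≠ 0) (m : ℕ) (x : α) :
    |birkhoffAverage ℝ T (birkhoffAverage ℝ T u k) m x - birkhoffAverage ℝ T u m x|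
      ≤ k / m := by
  have hshift (j : ℕ) :
      |birkhoffAverage ℝ T u m (T^[j] x) - birkhoffAverage ℝ T u m x| ≤ j / m := by
    induction j with
    | zero => simp
    | succ j ih =>
      have h := dist_birkhoffAverage_apply_birkhoffAverage ℝ T u m (T^[j] x)
      rw [Real.dist_eq, Real.dist_eq] at h
      rw [Function.iterate_succ_apply']
      refine (abs_sub_le _ (birkhoffAverage ℝ T u m (T^[j] x)) _).trans ?_
      rw [h]
      calc _ ≤ (1 : ℝ) / m + j / m := by gcongr; exact hu _ _
        _ = _ := by push_cast; ring
  have hswap : birkhoffAverage ℝ T (birkhoffAverage ℝ T u k) m x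
      = (k : ℝ)⁻¹ * ∑ j ∈ Finset.range k, birkhoffAverage ℝ T u m (T^[j] x) := by
    simp only [birkhoffAverage, birkhoffSum, smul_eq_mul, ← Finset.mul_sum]
    rw [Finset.sum_comm]
    simp only [← Function.iterate_add_apply, add_comm]
    ring
  have hk' : (k : ℝ) ≠ 0 := by exact_mod_cast hk
  have hdiff : birkhoffAverage ℝ T (birkhoffAverage ℝ T u k) m x - birkhoffAverage ℝ T u m x
      = (k : ℝ)⁻¹ * ∑ j ∈ Finset.range k,
        (birkhoffAverage ℝ T u m (T^[j] x) - birkhoffAverage ℝ T u m x) := by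
    rw [hswap, Finset.sum_sub_distrib, Finset.sum_const, Finset.card_range, nsmul_eq_mul, mul_sub,
      inv_mul_cancel_left₀ hk']
  rw [hdiff, abs_mul, abs_of_nonneg (by positivity : (0 : ℝ) ≤ (k : ℝ)⁻¹)]
  have hsum : |∑ j ∈ Finset.range k,
      (birkhoffAverage ℝ T u m (T^[j] x) - birkhoffAverage ℝ T u m x)| ≤ k * ((k : ℝ) / m) := by
    refine (Finset.abs_sum_le_sum_abs _ _).trans ?_
    have : ∑ j ∈ Finset.range k, (k : ℝ) / m = k * ((k : ℝ) / m) := by simp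
    rw [← this]
    refine Finset.sum_le_sum fun j hj => (hshift j).trans ?_
    have : (j : ℝ) ≤ k := by exact_mod_cast (Finset.mem_range.1 hj).le
    gcongr
  calc _ ≤ (k : ℝ)⁻¹ * (k * ((k : ℝ) / m)) := by gcongr
    _ = _ := inv_mul_cancel_left₀ hk' _

/-- The mean deviation of long averages is controlled by that of shorter ones. -/
theorem MeasureTheory.MeasurePreserving.integral_abs_birkhoffAverage_sub_le {α : Type*}
    [MeasurableSpace α] {μ : Measure α} [IsProbabilityMeasure μ] {T : α → α}
    (hT : MeasurePreserving T μ μ) {u : α → ℝ} (hu : Integrable u μ)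
    (hosc : ∀ x y, |u x - u y| ≤ 1) (c : ℝ) {k m : ℕ} (hk : k ≠ 0) (hm : m ≠ 0) :
    ∫ x, |birkhoffAverage ℝ T u m x - c| ∂μ
      ≤ ∫ x, |birkhoffAverage ℝ T u k x - c| ∂μ + k / m := by
  have hm' : (m : ℝ) ≠ 0 := by exact_mod_cast hm
  set v : α → ℝ := fun x => birkhoffAverage ℝ T u k x - c with hv
  have hvi : Integrable v μ := (hT.integrable_birkhoffAverage hu k).sub (integrable_const c)
  have hvavg (x : α) : birkhoffAverage ℝ T v m x
      = birkhoffAverage ℝ T (birkhoffAverage ℝ T u k) m x - c := by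
    simp only [hv, birkhoffAverage, birkhoffSum, Finset.sum_sub_distrib, smul_eq_mul,
      Finset.sum_const, Finset.card_range, nsmul_eq_mul, mul_sub, inv_mul_cancel_left₀ hm']
  calc ∫ x, |birkhoffAverage ℝ T u m x - c| ∂μ
      ≤ ∫ x, (|birkhoffAverage ℝ T v m x| + k / m) ∂μ := by
        refine integral_mono ((hT.integrable_birkhoffAverage hu m).sub (integrable_const c)).abs
          ((hT.integrable_birkhoffAverage hvi m).abs.add (integrable_const _)) fun x => ?_
        have h1 := abs_birkhoffAverage_birkhoffAverage_sub_le (T := T) hosc hk m x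
        rw [abs_sub_comm] at h1
        have h2 := abs_add_le (birkhoffAverage ℝ T u m x
          - birkhoffAverage ℝ T (birkhoffAverage ℝ T u k) m x) (birkhoffAverage ℝ T v m x)
        have h3 : birkhoffAverage ℝ T u m x
          - birkhoffAverage ℝ T (birkhoffAverage ℝ T u k) m x + birkhoffAverage ℝ T v m x
          = birkhoffAverage ℝ T u m x - c := by rw [hvavg]; ring
        rw [h3] at h2
        simp only
        linarith
    _ = ∫ x, |birkhoffAverage ℝ T v m x| ∂μ + k / m := by
        rw [integral_add (hT.integrable_birkhoffAverage hvi m).abs (integrable_const _)]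
        simp
    _ ≤ _ := by
        have := hT.integral_abs_birkhoffAverage_le hvi hm
        linarith

/-- **Mean ergodic theorem** in `L¹` form: the Birkhoff averages of a square integrable function
along an ergodic map converge in mean to its space average. -/
theorem Ergodic.tendsto_integral_abs_birkhoffAverage_sub {α : Type*} [MeasurableSpace α]
    {μ : Measure α} [IsProbabilityMeasure μ] {T : α → α} (hT : Ergodic T μ) {g : α → ℝ}
    (hg : MemLp g 2 μ) :
    Tendsto (fun k => ∫ x, |birkhoffAverage ℝ T g k x - ∫ y, g y ∂μ| ∂μ) atTop (𝓝 0) := by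
  have hmp : MeasurePreserving T μ μ := hT.toMeasurePreserving
  let U : Lp ℝ 2 μ →L[ℝ] Lp ℝ 2 μ :=
    (Lp.compMeasurePreservingₗᵢ ℝ T hmp).toContinuousLinearMap
  have hU : ‖U‖ ≤ 1 := LinearIsometry.norm_toContinuousLinearMap_le _
  have hUcoe (f : Lp ℝ 2 μ) : U f =ᵐ[μ] f ∘ T := Lp.coeFn_compMeasurePreserving f hmp
  have hlim := U.tendsto_birkhoffAverage_orthogonalProjection hU hg.toLp
  set P := (U.eqLocus (1 : Lp ℝ 2 μ →L[ℝ] Lp ℝ 2 μ)).orthogonalProjectionOnto hg.toLp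
  have hfix : U (P : Lp ℝ 2 μ) = P := P.2
  obtain ⟨c, hc⟩ := hT.ae_eq_const_of_ae_eq_comp_ae (Lp.aestronglyMeasurable (P : Lp ℝ 2 μ))
    ((hUcoe _).symm.trans (by rw [hfix]))
  have hiter (k : ℕ) : (U^[k] hg.toLp : α → ℝ) =ᵐ[μ] g ∘ T^[k] := by
    induction k with
    | zero => simpa using hg.coeFn_toLp
    | succ k ih =>
      rw [Function.iterate_succ_apply']
      refine (hUcoe _).trans ?_
      have := hmp.quasiMeasurePreserving.ae_eq_comp ih
      simpa [Function.comp_assoc, ← Function.iterate_succ] using this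
  have hsum (k : ℕ) :
      (birkhoffSum U _root_.id k hg.toLp : Lp ℝ 2 μ) =ᵐ[μ] birkhoffSum T g k := by
    induction k with
    | zero => simpa using Lp.coeFn_zero ℝ 2 μ
    | succ k ih =>
      rw [birkhoffSum_succ]
      filter_upwards [Lp.coeFn_add (birkhoffSum U _root_.id k hg.toLp) (U^[k] hg.toLp), ih,
        hiter k] with x h1 h2 h3
      rw [birkhoffSum_succ]
      simp only [id_eq]
      rw [h1, Pi.add_apply, h2, h3, Function.comp_apply]
  have havg (k : ℕ) :
      (birkhoffAverage ℝ U _root_.id k hg.toLp : Lp ℝ 2 μ) =ᵐ[μ] birkhoffAverage ℝ T g k := by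
    filter_upwards [Lp.coeFn_smul ((k : ℝ)⁻¹) (birkhoffSum U _root_.id k hg.toLp), hsum k]
      with x h1 h2
    rw [birkhoffAverage, h1, birkhoffAverage, Pi.smul_apply, h2]
  have hmem (k : ℕ) : MemLp (birkhoffAverage ℝ T g k) 2 μ :=
    (memLp_congr_ae (havg k)).1 (Lp.memLp _)
  have hint (k : ℕ) : Integrable (birkhoffAverage ℝ T g k) μ := (hmem k).integrable (by norm_num)
  have hc0 : Tendsto (fun k => ∫ x, |birkhoffAverage ℝ T g k x - c| ∂μ) atTop (𝓝 0) := by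
    have h2 := (Lp.tendsto_Lp_iff_tendsto_eLpNorm' _ _).1 hlim
    have h1 : Tendsto (fun k => eLpNorm (fun x => birkhoffAverage ℝ T g k x - c) 1 μ)
        atTop (𝓝 0) := by
      refine tendsto_of_tendsto_of_tendsto_of_le_of_le tendsto_const_nhds h2
        (fun _ => zero_le) fun k => ?_
      refine (eLpNorm_le_eLpNorm_of_exponent_le (q := 2) (by norm_num)
        ((hint k).aestronglyMeasurable.sub aestronglyMeasurable_const)).trans_eq ?_
      refine eLpNorm_congr_ae ?_
      filter_upwards [havg k, hc] with x h3 h4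
      exact (congrArg₂ (· - ·) h3 h4).symm
    have h3 := (ENNReal.tendsto_toReal ENNReal.zero_ne_top).comp h1
    refine (h3.congr fun k => ?_)
    have hi : Integrable (fun x => birkhoffAverage ℝ T g k x - c) μ :=
      (hint k).sub (integrable_const c)
    simp only [Function.comp_apply, eLpNorm_one_eq_lintegral_enorm]
    rw [← integral_norm_eq_lintegral_enorm hi.aestronglyMeasurable]
    rfl
  have hceq : ∫ y, g y ∂μ = c := by
    refine sub_eq_zero.1 (abs_eq_zero.1 (le_antisymm ?_ (abs_nonneg _)))
    refine ge_of_tendsto hc0 ?_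
    filter_upwards [eventually_ne_atTop 0] with k hk
    rw [← hmp.integral_birkhoffAverage (hg.integrable (by norm_num)) hk]
    have : (∫ x, birkhoffAverage ℝ T g k x ∂μ) - c
        = ∫ x, (birkhoffAverage ℝ T g k x - c) ∂μ := by
      rw [integral_sub (hint k) (integrable_const c)]; simp
    rw [this]
    exact abs_integral_le_integral_abs
  simpa only [hceq] using hc0

/-- A measurable function with bounded oscillation is integrable. -/
theorem integrable_of_abs_sub_le {α : Type*} [MeasurableSpace α] {μ : Measure α}
    [IsProbabilityMeasure μ] {u : α → ℝ} (hu : Measurable u) {C : ℝ}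
    (hC : ∀ x y, |u x - u y| ≤ C) : Integrable u μ := by
  obtain ⟨x₀⟩ := nonempty_of_isProbabilityMeasure μ
  refine Integrable.of_bound hu.aestronglyMeasurable (C + |u x₀|) (ae_of_all _ fun x => ?_)
  have h := abs_add_le (u x - u x₀) (u x₀)
  rw [sub_add_cancel] at h
  rw [Real.norm_eq_abs]
  linarith [hC x x₀]

/-- The integral of a function with oscillation at most `C` is within `C` of its values. -/
theorem abs_integral_sub_le {α : Type*} [MeasurableSpace α] {μ : Measure α}
    [IsProbabilityMeasure μ] {u : α → ℝ} (hu : Measurable u) {C : ℝ}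
    (hC : ∀ x y, |u x - u y| ≤ C) (x₀ : α) : |∫ x, u x ∂μ - u x₀| ≤ C := by
  have hi : Integrable u μ := integrable_of_abs_sub_le hu hC
  have h : ∫ x, u x ∂μ - u x₀ = ∫ x, (u x - u x₀) ∂μ := by
    rw [integral_sub hi (integrable_const _)]; simp
  rw [h]
  simpa using norm_integral_le_of_norm_le_const (μ := μ) (f := fun x => u x - u x₀)
    (ae_of_all _ fun x => hC x x₀)

theorem measurable_shift {Θ : Type*} [MeasurableSpace Θ] :
    Measurable (shift : (ℕ → Θ) → ℕ → Θ) :=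
  measurable_pi_lambda _ fun i => measurable_pi_apply (i + 1)

theorem shift_iterate_apply {Θ : Type*} (θ : ℕ → Θ) (i j : ℕ) :
    shift^[i] θ j = θ (j + i) := by
  induction i generalizing θ with
  | zero => rfl
  | succ i ih => rw [Function.iterate_succ_apply, ih]; simp [shift, add_assoc]

theorem birkhoffAverage_shift_apply {Θ : Type*} (g : Θ → ℝ) (k : ℕ) (θ : ℕ → Θ) :
    birkhoffAverage ℝ shift (fun θ => g (θ 0)) k θ
      = (k : ℝ)⁻¹ * ∑ i ∈ Finset.range k, g (θ i) := by
  simp [birkhoffAverage, birkhoffSum, shift_iterate_apply]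

theorem measurable_birkhoffAverage_shift {Θ : Type*} [MeasurableSpace Θ] {g : Θ → ℝ}
    (hg : Measurable g) (k : ℕ) :
    Measurable (birkhoffAverage ℝ shift (fun θ : ℕ → Θ => g (θ 0)) k) := by
  have h : birkhoffAverage ℝ shift (fun θ : ℕ → Θ => g (θ 0)) k
      = fun θ => (k : ℝ)⁻¹ * ∑ i ∈ Finset.range k, g (θ i) :=
    funext (birkhoffAverage_shift_apply g k)
  rw [h]
  fun_prop

section Sequences

variable {Θ : Type*} [PseudoMetricSpace Θ]

theorem summable_dInfty (hd : ∀ s t : Θ, dist s t ≤ 1) (a b : ℕ → Θ) :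
    Summable fun i : ℕ => (2 : ℝ)⁻¹ ^ (i + 1) * dist (a i) (b i) := by
  have hgeo : Summable fun i : ℕ => (2 : ℝ)⁻¹ ^ (i + 1) :=
    (summable_nat_add_iff 1).2 (summable_geometric_of_lt_one (by norm_num) (by norm_num))
  exact hgeo.of_nonneg_of_le (fun i => by positivity) fun i =>
    mul_le_of_le_one_right (by positivity) (hd _ _)

theorem dInfty_le_one (hd : ∀ s t : Θ, dist s t ≤ 1) (a b : ℕ → Θ) : dInfty a b ≤ 1 := by
  have hgeo : HasSum (fun i : ℕ => (2 : ℝ)⁻¹ ^ (i + 1)) 1 := by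
    have h := (hasSum_geometric_of_lt_one (r := (2 : ℝ)⁻¹) (by norm_num) (by norm_num)).mul_left
      (2 : ℝ)⁻¹
    simp only [← pow_succ'] at h
    norm_num at h
    simpa using h
  exact hasSum_le (fun i => mul_le_of_le_one_right (by positivity) (hd _ _))
    (summable_dInfty hd a b).hasSum hgeo

theorem dist_apply_le_dInfty (hd : ∀ s t : Θ, dist s t ≤ 1) (a b : ℕ → Θ) (i : ℕ) :
    dist (a i) (b i) ≤ 2 ^ (i + 1) * dInfty a b := by
  have h := (summable_dInfty hd a b).le_tsum i fun j _ => by positivity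
  calc dist (a i) (b i) = 2 ^ (i + 1) * ((2 : ℝ)⁻¹ ^ (i + 1) * dist (a i) (b i)) := by
        rw [← mul_assoc, ← mul_pow]; norm_num
    _ ≤ 2 ^ (i + 1) * dInfty a b := by gcongr; exact h

variable [MeasurableSpace Θ]

/-- The bounded Lipschitz distance controls integrals of `d_∞`-Lipschitz functions. -/
theorem abs_integral_sub_integral_le_blDistInfty (hd : ∀ s t : Θ, dist s t ≤ 1)
    (M N : Measure (ℕ → Θ)) [IsProbabilityMeasure M] [IsProbabilityMeasure N]
    {f : (ℕ → Θ) → ℝ} (hf : Measurable f) {L : ℝ} (hL : 0 < L)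
    (hfL : ∀ a b, |f a - f b| ≤ L * dInfty a b) :
    |∫ θ, f θ ∂M - ∫ θ, f θ ∂N| ≤ L * blDistInfty M N := by
  obtain ⟨a₀⟩ := nonempty_of_isProbabilityMeasure M
  have hbound : ∀ u ∈ BLoneSeq Θ, |∫ θ, u θ ∂M - ∫ θ, u θ ∂N| ≤ 2 := by
    intro u hu
    have hosc (a b) : |u a - u b| ≤ 1 := (hu.2 a b).trans (dInfty_le_one hd a b)
    have h1 := abs_integral_sub_le (μ := M) hu.1 hosc a₀
    have h2 := abs_integral_sub_le (μ := N) hu.1 hosc a₀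
    rw [abs_le] at *
    constructor <;> linarith
  have hmem : (fun θ => L⁻¹ * f θ) ∈ BLoneSeq Θ := by
    refine ⟨hf.const_mul _, fun a b => ?_⟩
    rw [← mul_sub, abs_mul, abs_of_pos (inv_pos.2 hL), inv_mul_le_iff₀ hL]
    exact hfL a b
  have hle : |∫ θ, L⁻¹ * f θ ∂M - ∫ θ, L⁻¹ * f θ ∂N| ≤ blDistInfty M N := by
    refine le_ciSup_of_le ⟨2, ?_⟩ (fun θ => L⁻¹ * f θ) ?_
    · rintro _ ⟨u, rfl⟩
      exact Real.iSup_le (fun hu => hbound u hu) (by norm_num)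
    · rw [ciSup_pos hmem]
  rw [integral_const_mul, integral_const_mul, ← mul_sub, abs_mul, abs_of_pos (inv_pos.2 hL),
    inv_mul_le_iff₀ hL] at hle
  exact hle

theorem tendsto_integral_of_tendsto_blDistInfty (hd : ∀ s t : Θ, dist s t ≤ 1)
    {M : ℕ → Measure (ℕ → Θ)} [∀ n, IsProbabilityMeasure (M n)]
    {Minf : Measure (ℕ → Θ)} [IsProbabilityMeasure Minf]
    (hconv : Tendsto (fun n => blDistInfty (M n) Minf) atTop (𝓝 0))
    {f : (ℕ → Θ) → ℝ} (hf : Measurable f) {L : ℝ} (hL : 0 < L)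
    (hfL : ∀ a b, |f a - f b| ≤ L * dInfty a b) :
    Tendsto (fun n => ∫ θ, f θ ∂M n) atTop (𝓝 (∫ θ, f θ ∂Minf)) := by
  rw [tendsto_iff_dist_tendsto_zero]
  refine squeeze_zero (fun _ => dist_nonneg)
    (fun n => abs_integral_sub_integral_le_blDistInfty hd (M n) Minf hf hL hfL) ?_
  simpa using hconv.const_mul L

theorem abs_birkhoffAverage_shift_sub_le (hd : ∀ s t : Θ, dist s t ≤ 1) {g : Θ → ℝ}
    (hg : g ∈ BLone Θ) {k : ℕ} (hk : k ≠ 0) (a b : ℕ → Θ) :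
    |birkhoffAverage ℝ shift (fun θ => g (θ 0)) k a
      - birkhoffAverage ℝ shift (fun θ => g (θ 0)) k b| ≤ 2 ^ k * dInfty a b := by
  have h := dist_birkhoffAverage_birkhoffAverage_le ℝ shift (fun θ : ℕ → Θ => g (θ 0)) k a b
  refine h.trans ?_
  have hk' : (0 : ℝ) < k := by exact_mod_cast Nat.pos_of_ne_zero hk
  have hD : 0 ≤ dInfty a b := tsum_nonneg fun i => by positivity
  rw [div_le_iff₀ hk']
  have hsum : ∑ i ∈ Finset.range k, 2 ^ k * dInfty a b = 2 ^ k * dInfty a b * k := by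
    simp [mul_comm]
  rw [← hsum]
  refine Finset.sum_le_sum fun i hi => ?_
  simp only [shift_iterate_apply, zero_add]
  refine (hg.2 _ _).trans ((dist_apply_le_dInfty hd a b i).trans ?_)
  gcongr
  · norm_num
  · exact Finset.mem_range.1 hi

/-- For a single Lipschitz test function the time averages along `M_n` concentrate around the
space averages. -/
theorem tendsto_integral_abs_birkhoffAverage_shift_sub (hd : ∀ s t : Θ, dist s t ≤ 1)
    {M : ℕ → Measure (ℕ → Θ)} [∀ n, IsProbabilityMeasure (M n)]
    (hstat : ∀ n, (M n).map shift = M n)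
    {Minf : Measure (ℕ → Θ)} [IsProbabilityMeasure Minf] (hergodic : Ergodic shift Minf)
    (hconv : Tendsto (fun n => blDistInfty (M n) Minf) atTop (𝓝 0))
    {mseq : ℕ → ℕ} (hmseq : Tendsto mseq atTop atTop) {g : Θ → ℝ} (hg : g ∈ BLone Θ) :
    Tendsto (fun n => ∫ θ, |birkhoffAverage ℝ shift (fun θ => g (θ 0)) (mseq n) θ
      - ∫ θ, g (θ 0) ∂M n| ∂M n) atTop (𝓝 0) := by
  set h : (ℕ → Θ) → ℝ := fun θ => g (θ 0)
  have hm : Measurable h := hg.1.comp (measurable_pi_apply 0)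
  have hosc (a b : ℕ → Θ) : |h a - h b| ≤ 1 := (hg.2 _ _).trans (hd _ _)
  have hmean : Tendsto (fun n => ∫ θ, h θ ∂M n) atTop (𝓝 (∫ θ, h θ ∂Minf)) :=
    tendsto_integral_of_tendsto_blDistInfty hd hconv hm (L := 2) (by norm_num) fun a b =>
      (hg.2 _ _).trans (by simpa using dist_apply_le_dInfty hd a b 0)
  set c := ∫ θ, h θ ∂Minf
  have hmem : MemLp h 2 Minf := by
    obtain ⟨a₀⟩ := nonempty_of_isProbabilityMeasure Minf
    refine MemLp.of_bound hm.aestronglyMeasurable (1 + |h a₀|) (ae_of_all _ fun x => ?_)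
    have h1 := abs_add_le (h x - h a₀) (h a₀)
    rw [sub_add_cancel] at h1
    rw [Real.norm_eq_abs]
    linarith [hosc x a₀]
  have herg := hergodic.tendsto_integral_abs_birkhoffAverage_sub hmem
  refine tendsto_order.2 ⟨fun e he => Eventually.of_forall fun n =>
    he.trans_le (integral_nonneg fun _ => abs_nonneg _), fun e he => ?_⟩
  obtain ⟨k, hke, hk⟩ := (((tendsto_order.1 herg).2 e he).and (eventually_ne_atTop 0)).exists
  have h1 : Tendsto (fun n => ∫ θ, |birkhoffAverage ℝ shift h k θ - c| ∂M n) atTop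
      (𝓝 (∫ θ, |birkhoffAverage ℝ shift h k θ - c| ∂Minf)) := by
    refine tendsto_integral_of_tendsto_blDistInfty hd hconv (L := 2 ^ k) ?_ (by positivity) ?_
    · exact ((measurable_birkhoffAverage_shift hg.1 k).sub_const c).abs
    · intro a b
      refine (abs_abs_sub_abs_le _ _).trans ?_
      rw [sub_sub_sub_cancel_right]
      exact abs_birkhoffAverage_shift_sub_le hd hg hk a b
  have h2 : Tendsto (fun n => |∫ θ, h θ ∂M n - c|) atTop (𝓝 0) := by
    simpa using (hmean.sub_const c).abs
  have h3 : Tendsto (fun n => (k : ℝ) / mseq n) atTop (𝓝 0) :=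
    (tendsto_const_div_atTop_nhds_zero_nat (k : ℝ)).comp hmseq
  have h4 := (h1.add h2).add h3
  simp only [add_zero] at h4
  filter_upwards [(tendsto_order.1 h4).2 e hke, hmseq.eventually_ne_atTop 0] with n hn hmn
  refine lt_of_le_of_lt ?_ hn
  have hT : MeasurePreserving shift (M n) (M n) := ⟨measurable_shift, hstat n⟩
  have hi : Integrable h (M n) := integrable_of_abs_sub_le hm hosc
  refine (hT.integral_abs_birkhoffAverage_sub_le hi hosc _ hk hmn).trans ?_
  gcongr
  have hib := hT.integrable_birkhoffAverage hi k
  calc ∫ θ, |birkhoffAverage ℝ shift h k θ - ∫ θ, h θ ∂M n| ∂M n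
      ≤ ∫ θ, (|birkhoffAverage ℝ shift h k θ - c| + |∫ θ, h θ ∂M n - c|) ∂M n := by
        refine integral_mono (hib.sub (integrable_const _)).abs
          ((hib.sub (integrable_const _)).abs.add (integrable_const _)) fun θ => ?_
        simp only
        rw [abs_sub_comm (∫ θ, h θ ∂M n) c]
        exact abs_sub_le _ _ _
    _ = _ := by
        have hi' : Integrable (fun θ => |birkhoffAverage ℝ shift h k θ - c|) (M n) :=
          (hib.sub (integrable_const c)).abs
        rw [integral_add hi' (integrable_const _)]
        simp

end Sequences

/-- Comparison of integrals of two functions with pointwise controlled difference. -/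
theorem abs_integral_sub_integral_le_of_abs_sub_le {Θ : Type*} [MeasurableSpace Θ]
    {μ : Measure Θ} [IsProbabilityMeasure μ] {f g r : Θ → ℝ} (hf : Integrable f μ)
    (hg : Integrable g μ)
    (hr : Integrable r μ) {δ : ℝ} (h : ∀ y, |f y - g y| ≤ δ + 2 * r y) :
    |∫ y, f y ∂μ - ∫ y, g y ∂μ| ≤ δ + 2 * ∫ y, r y ∂μ := by
  rw [← integral_sub hf hg]
  refine abs_integral_le_integral_abs.trans ?_
  have hi : Integrable (fun y => δ + 2 * r y) μ := (integrable_const δ).add (hr.const_mul 2)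
  refine (integral_mono (hf.sub hg).abs hi h).trans_eq ?_
  rw [integral_add (integrable_const δ) (hr.const_mul 2), integral_const_mul]
  simp

section LipschitzNet

variable {Θ : Type*} [PseudoMetricSpace Θ]

/-- The largest function that is `1`-Lipschitz and takes values at most `a i` at `x i`. -/
noncomputable def lipEnvelope {ι : Type*} (x : ι → Θ) (a : ι → ℝ) (y : Θ) : ℝ :=
  ⨅ i, (a i + dist y (x i))

variable {ι : Type*}

theorem lipEnvelope_zero_nonneg [Nonempty ι] (x : ι → Θ) (y : Θ) : 0 ≤ lipEnvelope x 0 y :=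
  le_ciInf fun i => by simp

variable [Finite ι]

theorem lipEnvelope_le (x : ι → Θ) (a : ι → ℝ) (y : Θ) (i : ι) :
    lipEnvelope x a y ≤ a i + dist y (x i) :=
  ciInf_le (Set.finite_range _).bddBelow i

variable [Nonempty ι]

theorem exists_lipEnvelope_eq (x : ι → Θ) (a : ι → ℝ) (y : Θ) :
    ∃ i, a i + dist y (x i) = lipEnvelope x a y :=
  exists_eq_ciInf_of_finite

theorem lipEnvelope_sub_le (x : ι → Θ) (a b : ι → ℝ) {δ : ℝ} (hab : ∀ i, a i ≤ b i + δ)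
    (y z : Θ) : lipEnvelope x a y - lipEnvelope x b z ≤ δ + dist y z := by
  obtain ⟨i, hi⟩ := exists_lipEnvelope_eq x b z
  rw [← hi]
  linarith [lipEnvelope_le x a y i, hab i, dist_triangle y z (x i)]

theorem lipEnvelope_mem_BLone [MeasurableSpace Θ] [OpensMeasurableSpace Θ] (x : ι → Θ)
    (a : ι → ℝ) : lipEnvelope x a ∈ BLone Θ := by
  have h (s t : Θ) : |lipEnvelope x a s - lipEnvelope x a t| ≤ dist s t := by
    have h1 := lipEnvelope_sub_le x a a (δ := 0) (by simp) s t
    have h2 := lipEnvelope_sub_le x a a (δ := 0) (by simp) t s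
    rw [dist_comm t s] at h2
    rw [abs_le]
    constructor <;> linarith
  exact ⟨(LipschitzWith.of_dist_le_mul (K := 1) fun s t => by
    simpa [Real.dist_eq] using h s t).continuous.measurable, h⟩

/-- A `1`-Lipschitz function is close to the envelope of approximations to its values at the
points `x i`, up to the distance to these points. -/
theorem abs_sub_lipEnvelope_le {f : Θ → ℝ} (hf : ∀ s t, |f s - f t| ≤ dist s t) (x : ι → Θ)
    {a : ι → ℝ} {δ : ℝ} (ha : ∀ i, |f (x i) - a i| ≤ δ) (y : Θ) :
    |f y - lipEnvelope x a y| ≤ δ + 2 * lipEnvelope x 0 y := by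
  obtain ⟨i, hi⟩ := exists_lipEnvelope_eq x a y
  obtain ⟨j, hj⟩ := exists_lipEnvelope_eq x 0 y
  have h0 := lipEnvelope_zero_nonneg x y
  simp only [Pi.zero_apply, zero_add] at hj
  have h1 := lipEnvelope_le x a y j
  rw [hj] at h1
  have h2 := abs_le.1 (hf y (x i))
  have h3 := abs_le.1 (hf y (x j))
  rw [hj] at h3
  have h4 := abs_le.1 (ha i)
  have h5 := abs_le.1 (ha j)
  rw [abs_le]
  constructor <;> linarith

variable [MeasurableSpace Θ]

theorem integrable_of_mem_BLone (hd : ∀ s t : Θ, dist s t ≤ 1) {μ : Measure Θ}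
    [IsProbabilityMeasure μ] {f : Θ → ℝ} (hf : f ∈ BLone Θ) : Integrable f μ :=
  integrable_of_abs_sub_le hf.1 fun s t => (hf.2 s t).trans (hd s t)

/-- The bounded Lipschitz distance is controlled by finitely many test functions, up to the mean
distance to finitely many points. -/
theorem exists_finset_blDist_le [OpensMeasurableSpace Θ] [Fintype ι]
    (hd : ∀ s t : Θ, dist s t ≤ 1) (x : ι → Θ) {δ : ℝ} (hδ : 0 < δ) :
    ∃ t : Finset (ι → ℝ), ∀ (μ ν : Measure Θ) [IsProbabilityMeasure μ] [IsProbabilityMeasure ν],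
      blDist μ ν ≤ ∑ a ∈ t, |∫ y, lipEnvelope x a y ∂μ - ∫ y, lipEnvelope x a y ∂ν|
        + 2 * δ + 2 * ∫ y, lipEnvelope x 0 y ∂μ + 2 * ∫ y, lipEnvelope x 0 y ∂ν := by
  obtain ⟨t, htfin, ht⟩ := Metric.totallyBounded_iff.1
    (isCompact_Icc (a := fun _ : ι => (-1 : ℝ)) (b := fun _ => 1)).totallyBounded δ hδ
  refine ⟨htfin.toFinset, fun μ ν _ _ => ?_⟩
  have h0μ : 0 ≤ ∫ y, lipEnvelope x 0 y ∂μ := integral_nonneg (lipEnvelope_zero_nonneg x)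
  have h0ν : 0 ≤ ∫ y, lipEnvelope x 0 y ∂ν := integral_nonneg (lipEnvelope_zero_nonneg x)
  have hsum : 0 ≤ ∑ a ∈ htfin.toFinset,
      |∫ y, lipEnvelope x a y ∂μ - ∫ y, lipEnvelope x a y ∂ν| :=
    Finset.sum_nonneg fun _ _ => abs_nonneg _
  refine Real.iSup_le (fun f => Real.iSup_le (fun hf => ?_) (by positivity)) (by positivity)
  obtain ⟨i₀⟩ := ‹Nonempty ι›
  set f' : Θ → ℝ := fun y => f y - f (x i₀) with hf'
  have hf'mem : f' ∈ BLone Θ :=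
    ⟨hf.1.sub_const _, fun s t => by simpa [hf'] using hf.2 s t⟩
  have hIcc : (fun i => f' (x i)) ∈ Set.Icc (fun _ : ι => (-1 : ℝ)) (fun _ => 1) := by
    have h (i : ι) := abs_le.1 ((hf.2 (x i) (x i₀)).trans (hd _ _))
    exact ⟨fun i => (h i).1, fun i => (h i).2⟩
  obtain ⟨a, hat, hda⟩ := Set.mem_iUnion₂.1 (ht hIcc)
  have ha (i : ι) : |f' (x i) - a i| ≤ δ :=
    (dist_le_pi_dist (fun i => f' (x i)) a i).trans (Metric.mem_ball.1 hda).le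
  have hpt := abs_sub_lipEnvelope_le hf'mem.2 x ha
  have hint {ρ : Measure Θ} [IsProbabilityMeasure ρ] {u : Θ → ℝ} (hu : u ∈ BLone Θ) :
      Integrable u ρ := integrable_of_mem_BLone hd hu
  have hμ := abs_integral_sub_integral_le_of_abs_sub_le (μ := μ) (hint hf'mem)
    (hint (lipEnvelope_mem_BLone x a)) (hint (lipEnvelope_mem_BLone x 0)) hpt
  have hν := abs_integral_sub_integral_le_of_abs_sub_le (μ := ν) (hint hf'mem)
    (hint (lipEnvelope_mem_BLone x a)) (hint (lipEnvelope_mem_BLone x 0)) hpt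
  have hnorm {ρ : Measure Θ} [IsProbabilityMeasure ρ] :
      ∫ y, f y ∂ρ = ∫ y, f' y ∂ρ + f (x i₀) := by
    rw [hf', integral_sub (hint hf) (integrable_const _)]; simp
  have hsingle := Finset.single_le_sum
    (f := fun a => |∫ y, lipEnvelope x a y ∂μ - ∫ y, lipEnvelope x a y ∂ν|)
    (fun _ _ => abs_nonneg _) (htfin.mem_toFinset.2 hat)
  rw [hnorm (ρ := μ), hnorm (ρ := ν), add_sub_add_right_eq_sub]
  refine le_trans ?_ (by gcongr)
  have hs := le_abs_self (∫ y, lipEnvelope x a y ∂μ - ∫ y, lipEnvelope x a y ∂ν)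
  have hs' := neg_abs_le (∫ y, lipEnvelope x a y ∂μ - ∫ y, lipEnvelope x a y ∂ν)
  have hμ' := abs_le.1 hμ
  have hν' := abs_le.1 hν
  rw [abs_le]
  constructor <;> linarith

end LipschitzNet

/-- The distance to the first `N + 1` points of a dense sequence has mean tending to zero. -/
theorem tendsto_integral_lipEnvelope_denseSeq {Θ : Type*} [PseudoMetricSpace Θ] [Nonempty Θ]
    [TopologicalSpace.SeparableSpace Θ] [MeasurableSpace Θ] [OpensMeasurableSpace Θ]
    (hd : ∀ s t : Θ, dist s t ≤ 1) (μ : Measure Θ) [IsProbabilityMeasure μ] :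
    Tendsto (fun N : ℕ => ∫ y, lipEnvelope
      (fun i : Fin (N + 1) => TopologicalSpace.denseSeq Θ i) 0 y ∂μ) atTop (𝓝 0) := by
  have hle (N : ℕ) (y : Θ) (i : Fin (N + 1)) :
      lipEnvelope (fun i : Fin (N + 1) => TopologicalSpace.denseSeq Θ i) 0 y
        ≤ dist y (TopologicalSpace.denseSeq Θ i) := by
    simpa using lipEnvelope_le (fun i : Fin (N + 1) => TopologicalSpace.denseSeq Θ i) 0 y i
  have h := tendsto_integral_of_dominated_convergence (μ := μ) (f := fun _ : Θ => (0 : ℝ))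
    (F := fun (N : ℕ) y => lipEnvelope
      (fun i : Fin (N + 1) => TopologicalSpace.denseSeq Θ i) 0 y) (fun _ => 1)
    (fun N => (lipEnvelope_mem_BLone _ _).1.aestronglyMeasurable) (integrable_const 1)
    (fun N => ae_of_all _ fun y => ?_) (ae_of_all _ fun y => ?_)
  · simpa using h
  · rw [Real.norm_of_nonneg (lipEnvelope_zero_nonneg _ _)]
    exact (hle N y 0).trans (hd _ _)
  · refine tendsto_order.2 ⟨fun e he => Eventually.of_forall fun N =>
      he.trans_le (lipEnvelope_zero_nonneg _ _), fun e he => ?_⟩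
    obtain ⟨i, hi⟩ := (TopologicalSpace.denseRange_denseSeq Θ).exists_dist_lt y he
    filter_upwards [eventually_ge_atTop i] with N hN
    exact (hle N y ⟨i, Nat.lt_succ_of_le hN⟩).trans_lt hi

theorem isProbabilityMeasure_emp {Θ : Type*} [MeasurableSpace Θ] (θ : ℕ → Θ) {m : ℕ}
    (hm : m ≠ 0) : IsProbabilityMeasure (emp θ m) := by
  constructor
  simp only [emp, Measure.smul_apply, Measure.finsetSum_apply, measure_univ, Finset.sum_const,
    Finset.card_range, smul_eq_mul, nsmul_eq_mul, mul_one]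
  exact ENNReal.inv_mul_cancel (by exact_mod_cast hm) (ENNReal.natCast_ne_top m)

theorem integral_emp {Θ : Type*} [MeasurableSpace Θ] {g : Θ → ℝ} (hg : Measurable g)
    (θ : ℕ → Θ) (m : ℕ) :
    ∫ y, g y ∂emp θ m = birkhoffAverage ℝ shift (fun θ => g (θ 0)) m θ := by
  rw [birkhoffAverage_shift_apply, emp, integral_smul_measure,
    integral_finsetSum_measure fun i _ => integrable_dirac' hg.stronglyMeasurable (by simp)]
  simp [integral_dirac' _ _ hg.stronglyMeasurable]

/-- Let `Θ` be complete separable with `d ≤ 1`. If `M_n` are shift-stationary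
probability measures on `Θ^{ℕ₀}` with invariant marginals `Π_n`, `M_∞` is stationary and
ergodic with invariant marginal `Π_∞`, and `w_∞(M_n, M_∞) → 0`, then for every sequence
`m_n → ∞` one has `R_{m_n}(M_n, Π_n) → 0`. -/
theorem stationary_sequence_consistent {Θ : Type*} [MetricSpace Θ] [CompleteSpace Θ]
    [TopologicalSpace.SeparableSpace Θ] [MeasurableSpace Θ] [BorelSpace Θ]
    (hd : ∀ s t : Θ, dist s t ≤ 1)
    (M : ℕ → Measure (ℕ → Θ)) [∀ n, IsProbabilityMeasure (M n)]
    (hstat : ∀ n, (M n).map shift = M n)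
    (target : ℕ → Measure Θ) (htarget : ∀ n, target n = (M n).map fun θ => θ 0)
    (Minf : Measure (ℕ → Θ)) [IsProbabilityMeasure Minf]
    (hergodic : Ergodic shift Minf)
    (hconv : Tendsto (fun n => blDistInfty (M n) Minf) atTop (𝓝 0))
    (mseq : ℕ → ℕ) (hmseq : Tendsto mseq atTop atTop) :
    Tendsto (fun n => risk (M n) (target n) (mseq n)) atTop (𝓝 0) := by
  have hm0 : Measurable fun θ : ℕ → Θ => θ 0 := measurable_pi_apply 0
  have htprob (n : ℕ) : IsProbabilityMeasure (target n) := by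
    rw [htarget n]; exact Measure.isProbabilityMeasure_map hm0.aemeasurable
  have hinfprob : IsProbabilityMeasure (Minf.map fun θ => θ 0) :=
    Measure.isProbabilityMeasure_map hm0.aemeasurable
  have : Nonempty Θ := nonempty_of_isProbabilityMeasure (target 0)
  have hmap (n : ℕ) {g : Θ → ℝ} (hg : Measurable g) :
      ∫ y, g y ∂target n = ∫ θ, g (θ 0) ∂M n := by
    rw [htarget n, integral_map hm0.aemeasurable hg.aestronglyMeasurable]
  have hblDist (μ ν : Measure Θ) : 0 ≤ blDist μ ν :=
    Real.iSup_nonneg fun f => Real.iSup_nonneg fun _ => abs_nonneg _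
  refine tendsto_order.2 ⟨fun e he => Eventually.of_forall fun n =>
    he.trans_le (integral_nonneg fun _ => hblDist _ _), fun e he => ?_⟩
  obtain ⟨N, hN⟩ := ((tendsto_order.1 (tendsto_integral_lipEnvelope_denseSeq hd
    (Minf.map fun θ => θ 0))).2 (e / 8) (by positivity)).exists
  set x : Fin (N + 1) → Θ := fun i => TopologicalSpace.denseSeq Θ i
  have hE (a : Fin (N + 1) → ℝ) : lipEnvelope x a ∈ BLone Θ := lipEnvelope_mem_BLone x a
  rw [integral_map hm0.aemeasurable (hE 0).1.aestronglyMeasurable] at hN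
  obtain ⟨t, ht⟩ := exists_finset_blDist_le hd x (δ := e / 8) (by positivity)
  have hr : Tendsto (fun n => ∫ θ, lipEnvelope x 0 (θ 0) ∂M n) atTop
      (𝓝 (∫ θ, lipEnvelope x 0 (θ 0) ∂Minf)) :=
    tendsto_integral_of_tendsto_blDistInfty hd hconv ((hE 0).1.comp hm0) (L := 2) (by norm_num)
      fun a b => ((hE 0).2 _ _).trans (by simpa using dist_apply_le_dInfty hd a b 0)
  have hs := tendsto_finsetSum t fun a _ =>
    tendsto_integral_abs_birkhoffAverage_shift_sub hd hstat hergodic hconv hmseq (hE a)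
  have hlim := (hs.add_const (2 * (e / 8))).add (hr.const_mul 4)
  rw [Finset.sum_const_zero, zero_add] at hlim
  filter_upwards [(tendsto_order.1 hlim).2 e (by linarith), hmseq.eventually_ne_atTop 0]
    with n hn hmn
  refine lt_of_le_of_lt ?_ hn
  have hT : MeasurePreserving shift (M n) (M n) := ⟨measurable_shift, hstat n⟩
  have hi (a : Fin (N + 1) → ℝ) : Integrable (fun θ => lipEnvelope x a (θ 0)) (M n) :=
    integrable_of_abs_sub_le ((hE a).1.comp hm0) fun _ _ => ((hE a).2 _ _).trans (hd _ _)
  have hdev (a : Fin (N + 1) → ℝ) : Integrable (fun θ =>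
      |birkhoffAverage ℝ shift (fun θ => lipEnvelope x a (θ 0)) (mseq n) θ
        - ∫ θ, lipEnvelope x a (θ 0) ∂M n|) (M n) :=
    ((hT.integrable_birkhoffAverage (hi a) _).sub (integrable_const _)).abs
  have hsumi := integrable_finsetSum t fun a _ => hdev a
  have havg := (hT.integrable_birkhoffAverage (hi 0) (mseq n)).const_mul 2
  have hmaj := (hsumi.add (integrable_const (2 * (e / 8)))).add havg
  have hmaj' := hmaj.add (integrable_const (2 * ∫ θ, lipEnvelope x 0 (θ 0) ∂M n))
  calc risk (M n) (target n) (mseq n)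
      ≤ ∫ θ, (∑ a ∈ t, |birkhoffAverage ℝ shift (fun θ => lipEnvelope x a (θ 0)) (mseq n) θ
          - ∫ θ, lipEnvelope x a (θ 0) ∂M n| + 2 * (e / 8)
          + 2 * birkhoffAverage ℝ shift (fun θ => lipEnvelope x 0 (θ 0)) (mseq n) θ
          + 2 * ∫ θ, lipEnvelope x 0 (θ 0) ∂M n) ∂M n := by
        refine integral_mono_of_nonneg (ae_of_all _ fun _ => hblDist _ _) hmaj'
          (ae_of_all _ fun θ => ?_)
        have := isProbabilityMeasure_emp θ hmn
        have h := ht (emp θ (mseq n)) (target n)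
        simpa only [integral_emp (hE _).1, hmap n (hE _).1] using h
    _ = _ := by
        rw [integral_add (by exact hmaj) (integrable_const _),
          integral_add (by exact hsumi.add (integrable_const _)) havg,
          integral_add hsumi (integrable_const _), integral_finsetSum _ fun a _ => hdev a]
        simp only [integral_const_mul, hT.integral_birkhoffAverage (hi 0) hmn, integral_const,
          probReal_univ, one_smul]
        ring
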